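/- Let 0 < α ≤ 2 and β ≥ 0. If A generates an (α,β)-ROF R_{α,β} that is exponentially stable (i.e. ‖R_{α,β}(t)‖ ≤ M e^{-δt} for some M ≥ 1, δ > 0, and all t ≥ 0) on a nonzero Banach space X, then (α,β) = (1,0). -/

import Mathlib

open MeasureTheory Set

/-- The Wright function `φ(ρ, μ; z) = ∑ z^k/(k! Γ(ρk+μ))`. -/
noncomputable def wright (ρ : ℝ) (μ : ℂ) (z : ℂ) : ℂ :=
  ∑' k : ℕ, z ^ k / ((k.factorial : ℂ) * Complex.Gamma ((ρ : ℂ) * k + μ))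

/-- Bessel function of the first kind of real order `ν` at a real argument. -/
noncomputable def besselJ (ν : ℝ) (x : ℝ) : ℝ :=
  (x / 2) ^ ν * ∑' k : ℕ, (-1 : ℝ) ^ k * (x / 2) ^ (2 * k) /
    ((k.factorial : ℝ) * Real.Gamma (ν + k + 1))

/-- Mittag-Leffler function. -/
noncomputable def mittagLeffler (a m : ℝ) (z : ℂ) : ℂ :=
  ∑' k : ℕ, z ^ k / Complex.Gamma ((a : ℂ) * k + m)

variable {X : Type*} [NormedAddCommGroup X] [NormedSpace ℂ X]

/-- `R` is the (bounded, everywhere-defined) resolvent `(z - A)⁻¹` of the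
(possibly unbounded) linear operator `A`; i.e. `z ∈ ρ(A)`. -/
structure IsResolventOf (A : X →ₗ.[ℂ] X) (z : ℂ) (R : X →L[ℂ] X) : Prop where
  mem : ∀ x : X, R x ∈ A.domain
  right : ∀ x : X, z • R x - A ⟨R x, mem x⟩ = x
  left : ∀ y : A.domain, R (z • (y : X) - A y) = y

/-- The open sector of half-angle `θ` around the positive real axis. -/
def sect (θ : ℝ) : Set ℂ := {z : ℂ | z ≠ 0 ∧ |Complex.arg z| < θ}

/-- `A` is sectorial of angle `ω`: the spectrum lies in the closed sector of angle `ω`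
(resolvents exist outside) and `‖z(z-A)⁻¹‖` is uniformly bounded outside each bigger
closed sector. -/
def IsSectorial (A : X →ₗ.[ℂ] X) (ω : ℝ) : Prop :=
  (∀ z ∈ (closure (sect ω))ᶜ, ∃ R : X →L[ℂ] X, IsResolventOf A z R) ∧
  ∀ ω' ∈ Set.Ioo ω Real.pi, ∃ M : ℝ,
    ∀ z ∈ (closure (sect ω'))ᶜ, ∀ R : X →L[ℂ] X, IsResolventOf A z R → ‖z‖ * ‖R‖ ≤ M

/-- `B = A⁻¹` as an unbounded operator. -/
def IsInverseOf (B A : X →ₗ.[ℂ] X) : Prop :=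
  (∀ x : A.domain, ∃ h : A x ∈ B.domain, B ⟨A x, h⟩ = (x : X)) ∧
  (∀ y : B.domain, ∃ h : B y ∈ A.domain, A ⟨B y, h⟩ = (y : X))

/-- Riemann–Liouville fractional integral of order `μ > 0`. -/
noncomputable def fracInt (μ : ℝ) (f : ℝ → X) (t : ℝ) : X :=
  ∫ s in Set.Ioo 0 t, ((t - s) ^ (μ - 1) / Real.Gamma μ) • f s

/-- `S` is a `β`-times integrated `α`-resolvent operator function generated by `A`,
with exponential bound `M e^{ω t}`. -/
structure IsROF (A : X →ₗ.[ℂ] X) (α β : ℝ) (S : ℝ → X →L[ℂ] X) (ω M : ℝ) : Prop where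
  cont : ∀ x : X, ContinuousOn (fun t : ℝ => S t x) (Set.Ici 0)
  bound : ∀ t : ℝ, 0 ≤ t → ‖S t‖ ≤ M * Real.exp (ω * t)
  laplace : ∀ l : ℝ, ω < l → ∃ R : X →L[ℂ] X,
    IsResolventOf A ((l ^ α : ℝ) : ℂ) R ∧
    ∀ x : X, ((l ^ (α - β - 1) : ℝ) : ℂ) • R x =
      ∫ t in Set.Ioi (0 : ℝ), Real.exp (-(l * t)) • S t x

/-- `S` is a tempered `β`-times integrated `α`-resolvent operator function generated
by `A`: `‖S t‖ ≤ M t^β` and the Laplace-transform identity holds for all `λ > 0`. -/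
structure IsTemperedROF (A : X →ₗ.[ℂ] X) (α β : ℝ) (S : ℝ → X →L[ℂ] X) (M : ℝ) : Prop where
  cont : ∀ x : X, ContinuousOn (fun t : ℝ => S t x) (Set.Ici 0)
  bound : ∀ t : ℝ, 0 ≤ t → ‖S t‖ ≤ M * t ^ β
  laplace : ∀ l : ℝ, 0 < l → ∃ R : X →L[ℂ] X,
    IsResolventOf A ((l ^ α : ℝ) : ℂ) R ∧
    ∀ x : X, ((l ^ (α - β - 1) : ℝ) : ℂ) • R x =
      ∫ t in Set.Ioi (0 : ℝ), Real.exp (-(l * t)) • S t x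

open Filter Topology

section LaplaceTransform

variable {E : Type*} [NormedAddCommGroup E] [NormedSpace ℂ E] {u : ℝ → E} {d C : ℝ}

/-- The Laplace transform of `u : [0, ∞) → E`. -/
noncomputable def laplaceInt (u : ℝ → E) (l : ℂ) : E :=
  ∫ t in Ioi (0 : ℝ), Complex.exp (-(l * t)) • u t

lemma norm_exp_smul_le (hu : ∀ t, 0 ≤ t → ‖u t‖ ≤ C * Real.exp (-(d * t))) (l : ℂ) {t : ℝ}
    (ht : 0 ≤ t) :
    ‖Complex.exp (-(l * t)) • u t‖ ≤ C * Real.exp (-(l.re + d) * t) := by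
  rw [norm_smul, Complex.norm_exp]
  calc _ ≤ Real.exp (-(l * t)).re * (C * Real.exp (-(d * t))) := by gcongr; exact hu t ht
    _ = C * Real.exp (-(l.re + d) * t) := by
      rw [mul_left_comm, ← Real.exp_add]
      congr 2
      simp
      ring

lemma aestronglyMeasurable_exp_smul (hc : ContinuousOn u (Ici 0)) (l : ℂ) :
    AEStronglyMeasurable (fun t : ℝ => Complex.exp (-(l * t)) • u t)
      (volume.restrict (Ioi (0 : ℝ))) := by
  refine ContinuousOn.aestronglyMeasurable ?_ measurableSet_Ioi
  exact ContinuousOn.smul (by fun_prop) (hc.mono Ioi_subset_Ici_self)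

lemma integrable_exp_smul (hc : ContinuousOn u (Ici 0))
    (hu : ∀ t, 0 ≤ t → ‖u t‖ ≤ C * Real.exp (-(d * t))) {l : ℂ} (hl : -d < l.re) :
    Integrable (fun t : ℝ => Complex.exp (-(l * t)) • u t) (volume.restrict (Ioi (0 : ℝ))) := by
  refine Integrable.mono' ((integrableOn_exp_mul_Ioi (a := -(l.re + d)) (by linarith) 0).const_mul C)
    (aestronglyMeasurable_exp_smul hc l) ?_
  refine (ae_restrict_iff' measurableSet_Ioi).2 (Eventually.of_forall fun t ht => ?_)
  exact norm_exp_smul_le hu l (le_of_lt ht)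

lemma norm_laplaceInt_le (hu : ∀ t, 0 ≤ t → ‖u t‖ ≤ C * Real.exp (-(d * t))) {l : ℂ}
    (hl : -d < l.re) : ‖laplaceInt u l‖ ≤ C / (l.re + d) := by
  have hneg : -(l.re + d) < 0 := by linarith
  have h := norm_integral_le_of_norm_le
    (μ := volume.restrict (Ioi (0 : ℝ))) (f := fun t : ℝ => Complex.exp (-(l * t)) • u t)
    ((integrableOn_exp_mul_Ioi hneg 0).const_mul C)
    ((ae_restrict_iff' measurableSet_Ioi).2
      (Eventually.of_forall fun t ht => norm_exp_smul_le hu l (le_of_lt ht)))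
  rw [integral_const_mul, integral_exp_mul_Ioi hneg] at h
  rwa [mul_zero, Real.exp_zero, neg_div_neg_eq, mul_one_div] at h

lemma differentiableOn_laplaceInt [CompleteSpace E] (hc : ContinuousOn u (Ici 0))
    (hu : ∀ t, 0 ≤ t → ‖u t‖ ≤ C * Real.exp (-(d * t))) :
    DifferentiableOn ℂ (laplaceInt u) {z | -d < z.re} := by
  intro l hl
  replace hl : -d < l.re := hl
  obtain ⟨e, he⟩ : ∃ e, e = (l.re + d) / 4 := ⟨_, rfl⟩
  have he0 : 0 < e := by linarith
  have h := hasDerivAt_integral_of_dominated_loc_of_deriv_le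
    (μ := volume.restrict (Ioi (0 : ℝ))) (𝕜 := ℂ)
    (F := fun (z : ℂ) (t : ℝ) => Complex.exp (-(z * t)) • u t)
    (F' := fun (z : ℂ) (t : ℝ) => (Complex.exp (-(z * t)) * -t) • u t)
    (x₀ := l) (s := Metric.ball l e)
    (bound := fun t => C / e * Real.exp (-(2 * e) * t))
    (Metric.ball_mem_nhds _ he0)
    (Eventually.of_forall fun z => aestronglyMeasurable_exp_smul hc z)
    (integrable_exp_smul hc hu hl) ?_ ?_
    ((integrableOn_exp_mul_Ioi (by linarith) 0).const_mul _) ?_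
  · exact h.2.differentiableAt.differentiableWithinAt
  · refine ContinuousOn.aestronglyMeasurable ?_ measurableSet_Ioi
    exact ContinuousOn.smul (by fun_prop) (hc.mono Ioi_subset_Ici_self)
  · refine (ae_restrict_iff' measurableSet_Ioi).2 (Eventually.of_forall fun t ht z hz => ?_)
    have ht0 : 0 < t := ht
    have hz' : l.re - e ≤ z.re := by
      have h1 := Complex.abs_re_le_norm (z - l)
      rw [← dist_eq_norm] at h1
      have h2 := neg_abs_le (z - l).re
      rw [Metric.mem_ball] at hz
      simp only [Complex.sub_re] at h1 h2
      linarith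
    have hC : 0 ≤ C := by simpa using (norm_nonneg _).trans (hu 0 le_rfl)
    have ht1 : t ≤ Real.exp (e * t) / e := by
      rw [le_div_iff₀ he0]
      linarith [Real.add_one_le_exp (e * t)]
    calc ‖(Complex.exp (-(z * t)) * -t) • u t‖
        = t * ‖Complex.exp (-(z * t)) • u t‖ := by
          simp [norm_smul, abs_of_pos ht0]
          ring
      _ ≤ (Real.exp (e * t) / e) * (C * Real.exp (-(z.re + d) * t)) := by
          gcongr
          exact norm_exp_smul_le hu z ht0.le
      _ ≤ (Real.exp (e * t) / e) * (C * Real.exp (-(3 * e) * t)) := by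
          gcongr
          linarith
      _ = C / e * Real.exp (-(2 * e) * t) := by
          rw [show -(2 * e) * t = e * t + -(3 * e) * t by ring, Real.exp_add]
          ring
  · refine Eventually.of_forall fun t z _ => ?_
    have h1 : HasDerivAt (fun z : ℂ => -(z * t)) (-t) z := by
      simpa using ((hasDerivAt_id z).mul_const (t : ℂ)).fun_neg
    exact h1.cexp.smul_const (u t)

end LaplaceTransform

section HalfPlane

variable {E : Type*} [NormedAddCommGroup E] [NormedSpace ℂ E]

lemma eq_of_eventuallyEq_real [CompleteSpace E] {a x₀ : ℝ} {f g : ℂ → E}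
    (hf : DifferentiableOn ℂ f {z | a < z.re}) (hg : DifferentiableOn ℂ g {z | a < z.re})
    (hx₀ : a < x₀) (h : ∀ᶠ l : ℝ in 𝓝 x₀, f l = g l) {z : ℂ} (hz : a < z.re) : f z = g z := by
  have ho : IsOpen {z : ℂ | a < z.re} := isOpen_lt continuous_const Complex.continuous_re
  refine (hf.analyticOnNhd ho).eqOn_of_preconnected_of_frequently_eq (hg.analyticOnNhd ho)
    (convex_halfSpace_re_gt a).isPreconnected (z₀ := (x₀ : ℂ)) (by simpa using hx₀) ?_ hz
  have ht : Tendsto (fun l : ℝ => (l : ℂ)) (𝓝[≠] x₀) (𝓝[≠] (x₀ : ℂ)) :=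
    tendsto_nhdsWithin_of_tendsto_nhds_of_eventually_within _
      (Complex.continuous_ofReal.tendsto x₀ |>.mono_left nhdsWithin_le_nhds)
      (eventually_mem_nhdsWithin.mono fun l hl => by simpa using hl)
  exact ht.frequently (h.filter_mono nhdsWithin_le_nhds).frequently

lemma eq_of_eq_real_gt [CompleteSpace E] {a w : ℝ} {f g : ℂ → E}
    (hf : DifferentiableOn ℂ f {z | a < z.re}) (hg : DifferentiableOn ℂ g {z | a < z.re})
    (h : ∀ l : ℝ, w < l → f l = g l) {z : ℂ} (hz : a < z.re) : f z = g z := by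
  refine eq_of_eventuallyEq_real (x₀ := max a w + 1) hf hg ?_ ?_ hz
  · exact (le_max_left a w).trans_lt (lt_add_one _)
  · filter_upwards [lt_mem_nhds (lt_add_one (max a w))] with l hl
    exact h l ((le_max_right a w).trans_lt hl)

/-- A holomorphic function decaying on a half-plane `-d < re z` that satisfies a reflection
symmetry in the strip `-d < re z < 0` vanishes. -/
lemma eq_zero_of_reflection {d K : ℝ} (hd : 0 < d) {f : ℂ → E} (s : ℂ) (hs : ‖s‖ = 1)
    (hf : DifferentiableOn ℂ f {z | -d < z.re})
    (hK : ∀ z : ℂ, -d < z.re → ‖f z‖ ≤ K / (z.re + d))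
    (hrefl : ∀ z : ℂ, -d < z.re → z.re < 0 → f z = s • f (-z)) {z : ℂ} (hz : -(d / 2) < z.re) :
    f z = 0 := by
  have ho : IsOpen {z : ℂ | -d < z.re} := isOpen_lt continuous_const Complex.continuous_re
  have hfd : ∀ z : ℂ, -d < z.re → DifferentiableAt ℂ f z := fun z hz =>
    hf.differentiableAt (ho.mem_nhds hz)
  have hK0 : 0 ≤ K := by
    have := (norm_nonneg _).trans (hK 0 (by simpa using hd))
    rw [Complex.zero_re, zero_add] at this
    exact (div_nonneg_iff.1 this).elim And.left fun h => absurd h.2 (not_le.2 hd)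
  classical
  set H : ℂ → E := fun z => if -(d / 2) < z.re then f z else s • f (-z) with hH
  have hdiff : Differentiable ℂ H := by
    intro z
    rcases lt_or_ge (-(d / 2)) z.re with hz | hz
    · refine (hfd z (by linarith)).congr_of_eventuallyEq ?_
      filter_upwards [(isOpen_lt continuous_const Complex.continuous_re).mem_nhds
        (show z ∈ {z : ℂ | -(d / 2) < z.re} from hz)] with y hy
      exact if_pos hy
    · have h1 : DifferentiableAt ℂ (fun z => s • f (-z)) z :=
        ((hfd (-z) (by simp; linarith)).comp z differentiableAt_id.neg).const_smul s
      refine h1.congr_of_eventuallyEq ?_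
      filter_upwards [(isOpen_lt Complex.continuous_re continuous_const).mem_nhds
        (show z ∈ {z : ℂ | z.re < 0} by simp; linarith)] with y hy
      by_cases hy2 : -(d / 2) < y.re
      · simp only [hH, if_pos hy2]
        exact hrefl y (by linarith) hy
      · simp only [hH, if_neg hy2]
  have hbound : Bornology.IsBounded (range H) := by
    refine isBounded_iff_forall_norm_le.2 ⟨K / (d / 2), ?_⟩
    rintro _ ⟨z, rfl⟩
    by_cases hz : -(d / 2) < z.re
    · simp only [hH, if_pos hz]
      refine (hK z (by linarith)).trans ?_
      gcongr
      linarith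
    · simp only [hH, if_neg hz, norm_smul, hs, one_mul]
      have h1 : d / 2 ≤ (-z).re := by simp only [Complex.neg_re]; linarith
      refine (hK (-z) (by linarith)).trans ?_
      gcongr
      linarith
  have hconst : ∀ l : ℝ, 0 < l → ‖H z‖ ≤ K / (l + d) := by
    intro l hl
    rw [hdiff.apply_eq_apply_of_bounded hbound z l]
    have h1 : -(d / 2) < (l : ℂ).re := by simp only [Complex.ofReal_re]; linarith
    simp only [hH, if_pos h1]
    simpa using hK l (by linarith)
  have hlim : Tendsto (fun l : ℝ => K / (l + d)) atTop (𝓝 0) :=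
    tendsto_const_nhds.div_atTop (tendsto_atTop_add_const_right _ _ tendsto_id)
  have hzero : ‖H z‖ ≤ 0 :=
    ge_of_tendsto hlim ((eventually_gt_atTop 0).mono hconst)
  have := norm_le_zero_iff.1 hzero
  simpa only [hH, if_pos hz] using this

end HalfPlane

section PowerIdentity

variable {E : Type*} [NormedAddCommGroup E] [NormedSpace ℂ E]

lemma add_two_pi_mul_I_cexp (a : ℝ) (t : ℂ) :
    Complex.exp (a * (t + 2 * Real.pi * Complex.I)) =
      Complex.exp (2 * Real.pi * Complex.I * a) * Complex.exp (a * t) := by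
  rw [← Complex.exp_add]
  ring_nf

lemma exists_int_of_cexp_eq_one {a : ℝ} (h : Complex.exp (2 * Real.pi * Complex.I * a) = 1) :
    ∃ n : ℤ, a = n := by
  obtain ⟨n, hn⟩ := Complex.exp_eq_one_iff.1 h
  refine ⟨n, ?_⟩
  rw [mul_comm] at hn
  exact_mod_cast mul_right_cancel₀ Complex.two_pi_I_ne_zero hn

/-- If `f` and `g` are holomorphic and decay on a half-plane containing `0` in its interior, an
identity `l ^ p • f l + l ^ q • g l = c ≠ 0` on the positive half-line forces `p` and `q` to be
integers with `p ≤ 0`. -/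
lemma exists_int_of_cpow_identity [CompleteSpace E] {f g : ℂ → E} {c : E} {d K w p q : ℝ}
    (hd : 0 < d) (hq : 0 < q) (hc : c ≠ 0)
    (hf : DifferentiableOn ℂ f {z | -d < z.re}) (hg : DifferentiableOn ℂ g {z | -d < z.re})
    (hfK : ∀ z : ℂ, -d < z.re → ‖f z‖ ≤ K / (z.re + d))
    (hgK : ∀ z : ℂ, -d < z.re → ‖g z‖ ≤ K / (z.re + d))
    (h : ∀ l : ℝ, w < l → (l : ℂ) ^ (p : ℂ) • f l + (l : ℂ) ^ (q : ℂ) • g l = c) :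
    p ≤ 0 ∧ (∃ n : ℤ, p = n) ∧ ∃ n : ℤ, q = n := by
  have hK0 : 0 ≤ K := by
    have := (norm_nonneg _).trans (hfK 0 (by simpa using hd))
    rw [Complex.zero_re, zero_add] at this
    exact (div_nonneg_iff.1 this).elim And.left fun h => absurd h.2 (not_le.2 hd)
  have hpow (a : ℝ) : DifferentiableOn ℂ (fun z : ℂ => z ^ (a : ℂ)) {z | 0 < z.re} := fun z hz =>
    (differentiableAt_id.cpow_const (Or.inl hz)).differentiableWithinAt
  have hsub : {z : ℂ | 0 < z.re} ⊆ {z | -d < z.re} := fun z hz => by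
    simp only [mem_ofPred_eq] at *
    linarith
  have hpos : ∀ z : ℂ, 0 < z.re → z ^ (p : ℂ) • f z + z ^ (q : ℂ) • g z = c := fun z hz =>
    eq_of_eq_real_gt (((hpow p).smul (hf.mono hsub)).add ((hpow q).smul (hg.mono hsub)))
      (differentiableOn_const c) h hz
  have hexp : ∀ z : ℂ, z.re < Real.log d →
      Complex.exp (p * z) • f (Complex.exp z) + Complex.exp (q * z) • g (Complex.exp z) = c := by
    have hmaps : MapsTo (fun z : ℂ => Complex.exp (-z)) {z | -Real.log d < z.re}
        {z | -d < z.re} := by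
      intro z hz
      simp only [mem_ofPred_eq] at *
      have h1 := neg_le_of_abs_le (Complex.abs_re_le_norm (Complex.exp (-z)))
      have h2 : ‖Complex.exp (-z)‖ < d := by
        rw [Complex.norm_exp, ← Real.lt_log_iff_exp_lt hd]
        simp only [Complex.neg_re]
        linarith
      linarith
    have hde : Differentiable ℂ (fun z : ℂ => Complex.exp (-z)) := by fun_prop
    have key : ∀ z : ℂ, -Real.log d < z.re →
        Complex.exp (p * -z) • f (Complex.exp (-z)) +
          Complex.exp (q * -z) • g (Complex.exp (-z)) = c := by
      intro z hz
      refine eq_of_eq_real_gt (w := 0) (f := fun z : ℂ =>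
        Complex.exp (p * -z) • f (Complex.exp (-z)) + Complex.exp (q * -z) • g (Complex.exp (-z)))
        (((by fun_prop : Differentiable ℂ _).differentiableOn.smul
          (hf.comp hde.differentiableOn hmaps)).add
        ((by fun_prop : Differentiable ℂ _).differentiableOn.smul
          (hg.comp hde.differentiableOn hmaps))) (differentiableOn_const c) (fun l _ => ?_) hz
      have hl : 0 < (Complex.exp (-(l : ℂ))).re := by
        rw [← Complex.ofReal_neg, Complex.exp_ofReal_re]
        positivity
      have hlog (a : ℝ) : Complex.exp (-(l : ℂ)) ^ (a : ℂ) = Complex.exp (a * -l) := by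
        rw [Complex.cpow_def_of_ne_zero (Complex.exp_ne_zero _), ← Complex.ofReal_neg,
          ← Complex.ofReal_exp, ← Complex.ofReal_log (Real.exp_pos _).le, Real.log_exp, mul_comm]
      simpa only [hlog] using hpos _ hl
    intro z hz
    simpa using key (-z) (by simpa using hz)
  have hnorm (a t : ℝ) (F : ℂ → E) (hF : ∀ z : ℂ, -d < z.re → ‖F z‖ ≤ K / (z.re + d)) :
      ‖Complex.exp (a * t) • F (Complex.exp t)‖ ≤ Real.exp (a * t) * (K / d) := by
    have h1 : 0 < (Complex.exp (t : ℂ)).re := by rw [Complex.exp_ofReal_re]; positivity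
    rw [norm_smul, ← Complex.ofReal_mul, Complex.norm_exp, Complex.ofReal_re]
    gcongr
    refine (hF _ (by linarith)).trans ?_
    gcongr
    linarith
  have htend (a : ℝ) (ha : 0 < a) (F : ℂ → E)
      (hF : ∀ z : ℂ, -d < z.re → ‖F z‖ ≤ K / (z.re + d)) :
      Tendsto (fun t : ℝ => Complex.exp (a * t) • F (Complex.exp t)) atBot (𝓝 0) := by
    refine squeeze_zero_norm (fun t => hnorm a t F hF) ?_
    simpa using (Real.tendsto_exp_atBot.comp (tendsto_id.const_mul_atBot ha)).mul_const (K / d)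
  have hev : ∀ᶠ t : ℝ in atBot, t < Real.log d := eventually_lt_atBot _
  have hp : p ≤ 0 := by
    by_contra! hp
    have h1 := (htend p hp f hfK).add (htend q hq g hgK)
    have h2 : Tendsto (fun _ : ℝ => c) atBot (𝓝 (0 + 0)) :=
      h1.congr' (hev.mono fun t ht => hexp t (by simpa using ht))
    exact hc (by simpa using tendsto_nhds_unique tendsto_const_nhds h2)
  set P := Complex.exp (2 * Real.pi * Complex.I * p) with hP
  set Q := Complex.exp (2 * Real.pi * Complex.I * q) with hQ
  have hper : ∀ t : ℝ, t < Real.log d →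
      (Q - P) • Complex.exp (q * t) • g (Complex.exp t) = (1 - P) • c := by
    intro t ht
    have h1 := hexp t (by simpa using ht)
    have h2 := hexp (t + 2 * Real.pi * Complex.I) (by simpa using ht)
    rw [add_two_pi_mul_I_cexp, add_two_pi_mul_I_cexp, Complex.exp_periodic, mul_smul, mul_smul,
      ← hP, ← hQ] at h2
    calc _ = (P • Complex.exp (p * t) • f (Complex.exp t) +
          Q • Complex.exp (q * t) • g (Complex.exp t)) -
          P • (Complex.exp (p * t) • f (Complex.exp t) +
            Complex.exp (q * t) • g (Complex.exp t)) := by module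
      _ = (1 - P) • c := by rw [h1, h2]; module
  have hP1 : P = 1 := by
    have h1 := (htend q hq g hgK).const_smul (Q - P)
    have h2 : Tendsto (fun _ : ℝ => (1 - P) • c) atBot (𝓝 ((Q - P) • (0 : E))) :=
      h1.congr' (hev.mono hper)
    have h3 := tendsto_nhds_unique tendsto_const_nhds h2
    rw [smul_zero, smul_eq_zero_iff_left hc] at h3
    exact (sub_eq_zero.1 h3).symm
  refine ⟨hp, exists_int_of_cexp_eq_one hP1, exists_int_of_cexp_eq_one ?_⟩
  rw [← hQ]
  by_contra hQ1
  have hg0 : ∀ z : ℂ, -d < z.re → g z = 0 := by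
    intro z hz
    refine eq_of_eventuallyEq_real (x₀ := d / 2) hg (differentiableOn_const 0) (by linarith) ?_ hz
    filter_upwards [lt_mem_nhds (half_pos hd), gt_mem_nhds (half_lt_self hd)] with l hl0 hl1
    have h1 := hper (Real.log l) (Real.log_lt_log hl0 hl1)
    rw [hP1, sub_self, zero_smul, ← Complex.ofReal_exp, Real.exp_log hl0,
      smul_eq_zero_iff_right (sub_ne_zero.2 hQ1),
      smul_eq_zero_iff_right (Complex.exp_ne_zero _)] at h1
    exact h1
  have hcle : ∀ l : ℝ, 1 ≤ l → ‖c‖ ≤ K / (l + d) := by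
    intro l hl
    have h1 := hpos l (by simp; linarith)
    rw [hg0 l (by simp; linarith), smul_zero, add_zero] at h1
    rw [← h1, norm_smul, Complex.norm_cpow_eq_rpow_re_of_pos (by linarith), Complex.ofReal_re]
    calc _ ≤ 1 * ‖f l‖ := by
          gcongr
          exact Real.rpow_le_one_of_one_le_of_nonpos hl hp
      _ ≤ K / (l + d) := by
          rw [one_mul]
          simpa using hfK l (by simp; linarith)
  have hlim : Tendsto (fun l : ℝ => K / (l + d)) atTop (𝓝 0) :=
    tendsto_const_nhds.div_atTop (tendsto_atTop_add_const_right _ _ tendsto_id)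
  exact hc (norm_le_zero_iff.1 (ge_of_tendsto hlim ((eventually_ge_atTop 1).mono hcle)))

end PowerIdentity

section Resolvent

variable {E : Type*} [NormedAddCommGroup E] [NormedSpace ℂ E] {A : E →ₗ.[ℂ] E}

lemma IsResolventOf.sub_apply {z w : ℂ} {R Q : E →L[ℂ] E} (hR : IsResolventOf A z R)
    (hQ : IsResolventOf A w Q) (x : E) : R x - Q x = (w - z) • R (Q x) := by
  have h1 := hR.left ⟨Q x, hQ.mem x⟩
  have h2 : A ⟨Q x, hQ.mem x⟩ = w • Q x - x := by
    have := hQ.right x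
    rw [sub_eq_iff_eq_add] at this
    rw [this]
    abel
  rw [h2] at h1
  simp only [map_sub, map_smul] at h1
  rw [sub_smul, sub_eq_iff_eq_add]
  nth_rw 3 [← h1]
  abel

lemma IsResolventOf.eq_zero {z : ℂ} {R : E →L[ℂ] E} (hR : IsResolventOf A z R) {x : E}
    (hx : R x = 0) : x = 0 := by
  have h1 : (⟨R x, hR.mem x⟩ : A.domain) = 0 := Subtype.ext hx
  rw [← hR.right x, h1, hx]
  simp

variable {α β ω M M' d : ℝ} {S : ℝ → E →L[ℂ] E}

lemma IsROF.exists_resolvent (hS : IsROF A α β S ω M) {l : ℝ} (hl0 : 0 < l) (hl : ω < l) :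
    ∃ R : E →L[ℂ] E, IsResolventOf A ((l : ℂ) ^ (α : ℂ)) R ∧
      ∀ x, R x = (l : ℂ) ^ ((β + 1 - α : ℝ) : ℂ) • laplaceInt (fun t => S t x) l := by
  obtain ⟨R, hR, h⟩ := hS.laplace l hl
  refine ⟨R, by rwa [Complex.ofReal_cpow hl0.le] at hR, fun x => ?_⟩
  have h1 : laplaceInt (fun t => S t x) l = ((l ^ (α - β - 1) : ℝ) : ℂ) • R x := by
    rw [h x, laplaceInt]
    congr 1
    ext t
    rw [← Complex.coe_smul]
    push_cast
    rfl
  rw [h1, smul_smul, ← Complex.ofReal_cpow hl0.le, ← Complex.ofReal_mul, ← Real.rpow_add hl0,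
    show β + 1 - α + (α - β - 1) = 0 by ring]
  simp

lemma IsROF.completeSpace [Nontrivial E] (hS : IsROF A α β S ω M) : CompleteSpace E := by
  by_contra hE
  obtain ⟨x, hx⟩ := exists_ne (0 : E)
  obtain ⟨R, hR, h⟩ := hS.exists_resolvent (l := max ω 0 + 1)
    (by linarith [le_max_right ω 0]) (by linarith [le_max_left ω 0])
  refine hx (hR.eq_zero ?_)
  rw [h, laplaceInt, integral_of_not_completeSpace hE, smul_zero]

lemma norm_apply_le_of_stable (hS : ∀ t, 0 ≤ t → ‖S t‖ ≤ M' * Real.exp (-(d * t))) (x : E)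
    (t : ℝ) (ht : 0 ≤ t) : ‖S t x‖ ≤ (M' * ‖x‖) * Real.exp (-(d * t)) := by
  rw [mul_right_comm]
  exact (S t).le_of_opNorm_le (hS t ht) x

lemma exists_clm_eq_laplaceInt (hc : ∀ x, ContinuousOn (fun t => S t x) (Ici 0))
    (hS : ∀ t, 0 ≤ t → ‖S t‖ ≤ M' * Real.exp (-(d * t))) {l : ℂ} (hl : -d < l.re) :
    ∃ T : E →L[ℂ] E, ∀ x, T x = laplaceInt (fun t => S t x) l := by
  have hint (x : E) := integrable_exp_smul (hc x) (norm_apply_le_of_stable hS x) hl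
  refine ⟨LinearMap.mkContinuous
    { toFun := fun x => laplaceInt (fun t => S t x) l
      map_add' := fun x y => ?_
      map_smul' := fun a x => ?_ } (M' / (l.re + d)) fun x => ?_, fun x => rfl⟩
  · simp only [laplaceInt, map_add, smul_add]
    exact integral_add (hint x) (hint y)
  · simp only [laplaceInt, map_smul, RingHom.id_apply, smul_comm _ a]
    exact integral_smul a _
  · refine (norm_laplaceInt_le (norm_apply_le_of_stable hS x) hl).trans_eq ?_
    ring

/-- For `α = 2` the resolvent identity extends to the half-plane `-d < re z`, which makes the
Laplace transform even or odd. -/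
lemma IsROF.laplaceInt_eq_zero [CompleteSpace E] (hS : IsROF A 2 β S ω M) (hd : 0 < d)
    (hbd : ∀ t, 0 ≤ t → ‖S t‖ ≤ M' * Real.exp (-(d * t))) (k : ℕ) (hk : β + k = 1) (x : E)
    {z : ℂ} (hz : -(d / 2) < z.re) : laplaceInt (fun t => S t x) z = 0 := by
  set F : ℂ → E → E := fun z x => laplaceInt (fun t => S t x) z with hF
  have hdiff (y : E) : DifferentiableOn ℂ (fun z => F z y) {z | -d < z.re} :=
    differentiableOn_laplaceInt (hS.cont y) (norm_apply_le_of_stable hbd y)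
  have hreal : ∀ l m : ℝ, max ω 0 < l → max ω 0 < m →
      (m : ℂ) ^ k • F l x - (l : ℂ) ^ k • F m x =
        ((m : ℂ) ^ 2 - (l : ℂ) ^ 2) • F l (F m x) := by
    have hres : ∀ l : ℝ, max ω 0 < l → ∃ R : E →L[ℂ] E, IsResolventOf A ((l : ℂ) ^ 2) R ∧
        ∀ x, F l x = (l : ℂ) ^ k • R x := by
      intro l hl
      have hl0 : 0 < l := (le_max_right _ _).trans_lt hl
      obtain ⟨R, hR, h⟩ := hS.exists_resolvent hl0 ((le_max_left _ _).trans_lt hl)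
      refine ⟨R, by simpa using hR, fun x => ?_⟩
      rw [h, smul_smul, ← Complex.cpow_natCast, ← Complex.cpow_add _ _ (by simpa using hl0.ne')]
      rw [show (k : ℂ) + ((β + 1 - 2 : ℝ) : ℂ) = ((β + k - 1 : ℝ) : ℂ) by push_cast; ring, hk]
      simp [hF]
    intro l m hl hm
    obtain ⟨R, hR, hRF⟩ := hres l hl
    obtain ⟨Q, hQ, hQF⟩ := hres m hm
    rw [hRF, hRF, hQF, map_smul, smul_comm ((m : ℂ) ^ k), ← smul_sub, ← smul_sub,
      hR.sub_apply hQ]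
    module
  have hleft : ∀ (l : ℂ) (m : ℝ), -d < l.re → max ω 0 < m →
      (m : ℂ) ^ k • F l x - l ^ k • F m x = ((m : ℂ) ^ 2 - l ^ 2) • F l (F m x) := by
    intro l m hl hm
    refine eq_of_eq_real_gt
      (f := fun l : ℂ => (m : ℂ) ^ k • F l x - l ^ k • F m x)
      (g := fun l : ℂ => ((m : ℂ) ^ 2 - l ^ 2) • F l (F m x))
      (((hdiff x).const_smul _).sub ?_) ?_ (fun l hl => hreal l m hl hm) hl
    · exact (by fun_prop : Differentiable ℂ fun l : ℂ => l ^ k • F m x).differentiableOn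
    · exact (by fun_prop : Differentiable ℂ fun l : ℂ => (m : ℂ) ^ 2 - l ^ 2).differentiableOn.smul
        (hdiff _)
  have hboth : ∀ l m : ℂ, -d < l.re → -d < m.re →
      m ^ k • F l x - l ^ k • F m x = (m ^ 2 - l ^ 2) • F l (F m x) := by
    intro l m hl hm
    obtain ⟨T, hT⟩ := exists_clm_eq_laplaceInt hS.cont hbd hl
    have hTF (y : E) : F l y = T y := (hT y).symm
    refine eq_of_eq_real_gt
      (f := fun m : ℂ => m ^ k • F l x - l ^ k • F m x)
      (g := fun m : ℂ => (m ^ 2 - l ^ 2) • F l (F m x))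
      (DifferentiableOn.sub ?_ ((hdiff x).const_smul _)) ?_ (fun m hm => hleft l m hl hm) hm
    · exact (by fun_prop : Differentiable ℂ fun m : ℂ => m ^ k • F l x).differentiableOn
    · simp only [hTF]
      exact (by fun_prop : Differentiable ℂ fun m : ℂ => m ^ 2 - l ^ 2).differentiableOn.smul
        (T.differentiable.comp_differentiableOn (hdiff x))
  refine eq_zero_of_reflection (K := M' * ‖x‖) (f := fun z => F z x) hd ((-1) ^ k) (by simp)
    (hdiff x) (fun z hz => norm_laplaceInt_le (norm_apply_le_of_stable hbd x) hz) ?_ hz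
  intro z hz hz0
  have h1 := hboth z (-z) hz (by simp; linarith)
  have hz1 : z ^ k ≠ 0 := pow_ne_zero _ fun h => by simp [h] at hz0
  rw [neg_sq, sub_self, zero_smul, sub_eq_zero, neg_pow, mul_comm, mul_smul] at h1
  have h2 := smul_right_injective E hz1 h1
  rw [← h2, smul_smul, ← mul_pow]
  simp

end Resolvent

theorem stmt11 {X : Type*} [NormedAddCommGroup X] [NormedSpace ℂ X] [Nontrivial X]
    (A : X →ₗ.[ℂ] X) (alpha beta : ℝ) (halpha0 : 0 < alpha) (halpha2 : alpha ≤ 2)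
    (hbeta : 0 ≤ beta)
    (S : ℝ → X →L[ℂ] X) (omega M : ℝ) (hS : IsROF A alpha beta S omega M)
    (M' d : ℝ) (hM' : 1 ≤ M') (hd : 0 < d)
    (hbd : ∀ t : ℝ, 0 ≤ t → ‖S t‖ ≤ M' * Real.exp (-(d * t))) :
    alpha = 1 ∧ beta = 0 := by
  have := hS.completeSpace
  obtain ⟨x, hx⟩ := exists_ne (0 : X)
  obtain ⟨m, hm0, hm⟩ : ∃ m : ℝ, 0 < m ∧ omega < m :=
    ⟨max omega 0 + 1, by linarith [le_max_right omega 0], by linarith [le_max_left omega 0]⟩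
  obtain ⟨Q, hQ, hQF⟩ := hS.exists_resolvent hm0 hm
  have hQx : Q x ≠ 0 := fun h => hx (hQ.eq_zero h)
  set y := x - (m : ℂ) ^ (alpha : ℂ) • Q x with hy
  have hmax : ∀ z ∈ ({y, Q x} : Set X), ∀ l : ℂ, -d < l.re →
      ‖laplaceInt (fun t => S t z) l‖ ≤ (M' * max ‖y‖ ‖Q x‖) / (l.re + d) := by
    intro z hz l hl
    refine (norm_laplaceInt_le (norm_apply_le_of_stable hbd z) hl).trans ?_
    have : 0 ≤ l.re + d := by linarith
    gcongr
    rcases hz with rfl | rfl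
    · exact le_max_left _ _
    · exact le_max_right _ _
  obtain ⟨hp, ⟨n, hn⟩, k, hk⟩ := exists_int_of_cpow_identity (w := max omega 0)
    (p := beta + 1 - alpha) (q := beta + 1) hd (by linarith) hQx
    (differentiableOn_laplaceInt (hS.cont y) (norm_apply_le_of_stable hbd y))
    (differentiableOn_laplaceInt (hS.cont (Q x)) (norm_apply_le_of_stable hbd (Q x)))
    (hmax y (by simp)) (hmax (Q x) (by simp)) (by
      intro l hl
      have hl0 : 0 < l := (le_max_right _ _).trans_lt hl
      obtain ⟨R, hR, hRF⟩ := hS.exists_resolvent hl0 ((le_max_left _ _).trans_lt hl)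
      have h1 : (l : ℂ) ^ ((beta + 1 : ℝ) : ℂ) =
          (l : ℂ) ^ (alpha : ℂ) * (l : ℂ) ^ ((beta + 1 - alpha : ℝ) : ℂ) := by
        rw [← Complex.cpow_add _ _ (by simpa using hl0.ne')]
        congr 1
        push_cast
        ring
      have h2 := hR.sub_apply hQ x
      rw [h1, mul_smul, ← hRF, ← hRF, hy, map_sub, map_smul]
      rw [sub_eq_iff_eq_add] at h2
      rw [h2]
      module)
  have halpha : alpha = ((k - n : ℤ) : ℝ) := by push_cast; linarith
  have hn0 : n ≤ 0 := by rw [hn] at hp; exact_mod_cast hp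
  have hk1 : 1 ≤ k := by
    have : (1 : ℝ) ≤ k := by linarith
    exact_mod_cast this
  rw [halpha] at halpha0 halpha2
  have h0 : 0 < k - n := by exact_mod_cast halpha0
  have h2 : k - n ≤ 2 := by exact_mod_cast halpha2
  obtain h | h : k - n = 1 ∨ k - n = 2 := by omega
  · obtain rfl : k = 1 := by omega
    rw [h] at halpha
    exact ⟨by simpa using halpha, by simpa using hk⟩
  · exfalso
    obtain ⟨j, hj⟩ : ∃ j : ℕ, k + j = 2 := ⟨(2 - k).toNat, by omega⟩
    obtain rfl : alpha = 2 := by rw [halpha, h]; norm_num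
    have hbj : beta + j = 1 := by
      have : (k : ℝ) + j = 2 := by exact_mod_cast hj
      linarith
    have hzero := hS.laplaceInt_eq_zero hd hbd j hbj x (z := m)
      (by rw [Complex.ofReal_re]; linarith)
    exact hQx (by rw [hQF, hzero, smul_zero])
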